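/- Every cone admits a strongly unitary embedding into a refinement cone; that is, for every cone M there exist a refinement cone N and a strongly unitary monoid homomorphism from M into N. -/

import Mathlib

universe u

/-- Conical commutative monoid ("cone"): `x + y = 0` implies `x = y = 0`. -/
def IsConical (M : Type u) [AddCommMonoid M] : Prop :=
  ∀ x y : M, x + y = 0 → x = 0 ∧ y = 0

/-- Algebraic preorder: `x ≤ y` iff `∃ z, x + z = y`. -/
def AlgLE {M : Type u} [AddCommMonoid M] (x y : M) : Prop :=
  ∃ z : M, x + z = y

/-- Refinement monoid. -/
def IsRefinementMonoid (M : Type u) [AddCommMonoid M] : Prop :=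
  ∀ a₀ a₁ b₀ b₁ : M, a₀ + a₁ = b₀ + b₁ →
    ∃ c₀₀ c₀₁ c₁₀ c₁₁ : M,
      a₀ = c₀₀ + c₀₁ ∧ a₁ = c₁₀ + c₁₁ ∧ b₀ = c₀₀ + c₁₀ ∧ b₁ = c₀₁ + c₁₁

/-- Unitary homomorphism: injective, cofinal image, and `f a₀ + b = f a₁ → b ∈ range f`. -/
def IsUnitary {A : Type u} {B : Type u} [AddCommMonoid A] [AddCommMonoid B]
    (f : A →+ B) : Prop :=
  Function.Injective f ∧
  (∀ b : B, ∃ a : A, AlgLE b (f a)) ∧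
  (∀ a₀ a₁ : A, ∀ b : B, f a₀ + b = f a₁ → b ∈ Set.range f)

/-- Strongly unitary homomorphism. -/
def IsStronglyUnitary {A : Type u} {B : Type u} [AddCommMonoid A] [AddCommMonoid B]
    (f : A →+ B) : Prop :=
  IsUnitary f ∧ ∀ m : ℕ, 0 < m → ∀ b : B, m • b ∈ Set.range f → b ∈ Set.range f

/-- Normally divisible commutative monoid. -/
def IsNormallyDivisible (M : Type u) [AddCommMonoid M] : Prop :=
  ∀ p : ℕ, 0 < p → ∀ X : Finset M, ∀ a : M,
    ∃ u : M, p • u = a ∧ ∀ x ∈ X, ∀ y ∈ X, x + a = y + a → x + u = y + u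

/-- Order-embedding of commutative monoids (w.r.t. the algebraic preorders). -/
def IsOrderEmbeddingHom {A : Type u} {B : Type u} [AddCommMonoid A] [AddCommMonoid B]
    (f : A →+ B) : Prop :=
  Function.Injective f ∧ ∀ x y : A, AlgLE x y ↔ AlgLE (f x) (f y)

/-- Simple commutative monoid: every `u ≰ 0` is an order-unit. -/
def IsSimpleMonoid (M : Type u) [AddCommMonoid M] : Prop :=
  ∀ u : M, ¬ AlgLE u 0 → ∀ x : M, ∃ n : ℕ, 0 < n ∧ AlgLE x (n • u)

/-- Weak sum decomposition axiom (WSD). -/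
def WSD (M : Type u) [AddCommMonoid M] : Prop :=
  ∀ a₀ a₁ b c : M, a₀ + a₁ + c = b + c →
    ∃ x₀ x₁ : M, a₀ + c = x₀ + c ∧ a₁ + c = x₁ + c ∧ b = x₀ + x₁

/-- `a ∝ b` : `a ≤ n • b` for some positive integer `n`. -/
def Propto {M : Type u} [AddCommMonoid M] (a b : M) : Prop :=
  ∃ n : ℕ, 0 < n ∧ AlgLE a (n • b)

/-- `a ≍ b` : `a ∝ b` and `b ∝ a`. -/
def Asymp {M : Type u} [AddCommMonoid M] (a b : M) : Prop :=
  Propto a b ∧ Propto b a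

/-- Cancellative commutative monoid. -/
def IsCancellativeMonoid (M : Type u) [AddCommMonoid M] : Prop :=
  ∀ x y z : M, x + z = y + z → x = y

/-- Separative commutative monoid. -/
def IsSeparative (M : Type u) [AddCommMonoid M] : Prop :=
  ∀ x y : M, 2 • x = x + y → x + y = 2 • y → x = y

/-- Stably finite commutative monoid. -/
def IsStablyFinite (M : Type u) [AddCommMonoid M] : Prop :=
  ∀ x y : M, x + y = y → x = 0

/-- Quasi-divisible commutative monoid. -/
def IsQuasiDivisible (M : Type u) [AddCommMonoid M] : Prop :=
  ∀ x : M, ∃ u v : M, 2 • u + 3 • v = x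

/-- `ℙ`-torsion-free commutative monoid. -/
def PTorsionFree (P : Set ℕ) (M : Type u) [AddCommMonoid M] : Prop :=
  ∀ p ∈ P, ∀ x y : M, p • x = p • y → x = y

/-- `ℙ`-unperforated commutative monoid (w.r.t. the algebraic preorder). -/
def PUnperforated (P : Set ℕ) (M : Type u) [AddCommMonoid M] : Prop :=
  ∀ p ∈ P, ∀ x y : M, AlgLE (p • x) (p • y) → AlgLE x y

/-- `f : A →+ B` refines `A` if every equation `a₀ + a₁ = b₀ + b₁` in `A` has a refinement
in `B`. -/
def Refines {A : Type u} {B : Type u} [AddCommMonoid A] [AddCommMonoid B] (f : A →+ B) : Prop :=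
  ∀ a₀ a₁ b₀ b₁ : A, a₀ + a₁ = b₀ + b₁ →
    ∃ c₀₀ c₀₁ c₁₀ c₁₁ : B,
      f a₀ = c₀₀ + c₀₁ ∧ f a₁ = c₁₀ + c₁₁ ∧ f b₀ = c₀₀ + c₁₀ ∧ f b₁ = c₀₁ + c₁₁

theorem IsConical.eq_zero_of_nsmul_eq_zero {M : Type u} [AddCommMonoid M] (hM : IsConical M)
    {n : ℕ} {a : M} (ha : a ≠ 0) (h : n • a = 0) : n = 0 := by
  cases n with
  | zero => rfl
  | succ n => exact absurd (hM _ _ ((succ_nsmul a n).symm.trans h)).2 ha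

theorem IsStronglyUnitary.id (A : Type u) [AddCommMonoid A] :
    IsStronglyUnitary (AddMonoidHom.id A) :=
  ⟨⟨fun _ _ h => h, fun b => ⟨b, 0, add_zero b⟩, fun _ _ b _ => ⟨b, rfl⟩⟩, fun _ _ b _ => ⟨b, rfl⟩⟩

theorem IsStronglyUnitary.comp {A B C : Type u} [AddCommMonoid A] [AddCommMonoid B]
    [AddCommMonoid C] {g : B →+ C} {f : A →+ B} (hg : IsStronglyUnitary g)
    (hf : IsStronglyUnitary f) : IsStronglyUnitary (g.comp f) := by
  obtain ⟨⟨ginj, gcof, guni⟩, gdiv⟩ := hg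
  obtain ⟨⟨finj, fcof, funi⟩, fdiv⟩ := hf
  refine ⟨⟨ginj.comp finj, fun c => ?_, fun a₀ a₁ c h => ?_⟩, fun m hm c h => ?_⟩
  · obtain ⟨b, z, hz⟩ := gcof c
    obtain ⟨a, y, hy⟩ := fcof b
    exact ⟨a, z + g y, by rw [← add_assoc, hz, ← map_add, hy]; rfl⟩
  · obtain ⟨b, rfl⟩ := guni _ _ _ h
    obtain ⟨a, rfl⟩ := funi a₀ a₁ b (ginj (by simpa using h))
    exact ⟨a, rfl⟩
  · obtain ⟨a', ha'⟩ := h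
    obtain ⟨b, rfl⟩ := gdiv m hm c ⟨f a', ha'⟩
    obtain ⟨a, rfl⟩ := fdiv m hm b ⟨a', ginj (by simpa using ha')⟩
    exact ⟨a, rfl⟩

section GradedQuotient

variable {F : Type u} {M : Type u} {G : Type u} [AddCommMonoid F] [AddCommMonoid M]
  [AddCommGroup G]

/-- The congruence on a graded monoid `F` induced by a map `Φ` meant to be evaluated in degree
zero only: two elements are identified if they have the same degree and cannot be separated by
`Φ` after translation into degree zero. -/
def degreeZeroCon (w : F →+ G) (Φ : F → M) : AddCon F where
  r x y := w x = w y ∧ ∀ z, w (x + z) = 0 → Φ (x + z) = Φ (y + z)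
  iseqv :=
    { refl := fun _ => ⟨rfl, fun _ _ => rfl⟩
      symm := fun {x y} h => ⟨h.1.symm, fun z hz =>
        (h.2 z (by rw [map_add, h.1, ← map_add, hz])).symm⟩
      trans := fun {x y t} h k => ⟨h.1.trans k.1, fun z hz =>
        (h.2 z hz).trans (k.2 z (by rw [map_add, ← h.1, ← map_add, hz]))⟩ }
  add' := fun {x y x' y'} h k => ⟨by rw [map_add, map_add, h.1, k.1], fun z hz => by
    have h₁ := h.2 (x' + z) (by rwa [← add_assoc])
    have h₂ := k.2 (y + z) (by
      rw [add_left_comm, map_add, ← h.1, ← map_add, ← add_assoc, hz])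
    rw [add_assoc, h₁, add_left_comm, h₂, add_assoc, add_left_comm]⟩

variable {w : F →+ G} {Φ : F → M}

theorem degreeZeroCon_mk_eq (hadd : ∀ x y, w x = 0 → w y = 0 → Φ (x + y) = Φ x + Φ y)
    {x y : F} (hx : w x = 0) (hy : w y = 0) (h : Φ x = Φ y) :
    (x : (degreeZeroCon w Φ).Quotient) = y := by
  refine (AddCon.eq _).2 ⟨hx.trans hy.symm, fun z hz => ?_⟩
  have hz' : w z = 0 := by rwa [map_add, hx, zero_add] at hz
  rw [hadd _ _ hx hz', hadd _ _ hy hz', h]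

theorem isConical_degreeZeroCon (hF : IsConical F) (h₀ : Φ 0 = 0) (hΦ : ∀ x, w x = 0 → Φ x = 0 → x = 0) :
    IsConical (degreeZeroCon w Φ).Quotient := by
  intro x y
  induction x using AddCon.induction_on with | H x
  induction y using AddCon.induction_on with | H y
  intro h
  rw [← AddCon.coe_add, ← AddCon.coe_zero, AddCon.eq] at h
  have hw : w (x + y) = 0 := h.1.trans (map_zero w)
  have hv : Φ (x + y) = 0 := by simpa [h₀] using h.2 0 (by simpa using hw)
  obtain ⟨rfl, rfl⟩ := hF _ _ (hΦ _ hw hv)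
  exact ⟨rfl, rfl⟩

theorem isStronglyUnitary_degreeZeroCon [IsAddTorsionFree G]
    (hadd : ∀ x y, w x = 0 → w y = 0 → Φ (x + y) = Φ x + Φ y)
    (ι : M →+ F) (hwι : ∀ m, w (ι m) = 0) (hΦι : ∀ m, Φ (ι m) = m)
    (hcof : ∀ x, ∃ z, w (x + z) = 0) :
    IsStronglyUnitary ((degreeZeroCon w Φ).mk'.comp ι) := by
  have mem_range : ∀ x : F, w x = 0 → (x : (degreeZeroCon w Φ).Quotient) ∈
      Set.range ((degreeZeroCon w Φ).mk'.comp ι) := fun x hx =>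
    ⟨Φ x, degreeZeroCon_mk_eq hadd (hwι _) hx (hΦι _)⟩
  refine ⟨⟨fun a b h => ?_, fun b => ?_, fun a₀ a₁ b => ?_⟩, fun m hm b => ?_⟩
  · have := ((AddCon.eq _).1 h).2 0 (by simp [hwι])
    simpa [hΦι] using this
  · induction b using AddCon.induction_on with | H x
    obtain ⟨z, hz⟩ := hcof x
    obtain ⟨a, ha⟩ := mem_range _ hz
    exact ⟨a, z, ha.symm⟩
  · induction b using AddCon.induction_on with | H x
    intro h
    have := ((AddCon.eq _).1 (show ((ι a₀ + x : F) : (degreeZeroCon w Φ).Quotient) = ι a₁ from h)).1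
    exact mem_range x (by simpa [hwι] using this)
  · induction b using AddCon.induction_on with | H x
    rintro ⟨a, h⟩
    have := ((AddCon.eq _).1 (show ((ι a : F) : (degreeZeroCon w Φ).Quotient) =
      ((m • x : F)) from h)).1
    rw [hwι, map_nsmul] at this
    exact mem_range x (nsmul_right_injective hm.ne' (by simp [← this]))

end GradedQuotient

section SquareEval

variable {M : Type u} [AddCommMonoid M]

/-- The degree of a `2 × 2` matrix `(c₀₀, c₀₁, c₁₀, c₁₁)`; it vanishes precisely on the sums of
rows and columns. -/
def squareDegree : ℕ × ℕ × ℕ × ℕ →+ ℤ where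
  toFun p := (p.1 + p.2.2.2 : ℤ) - (p.2.1 + p.2.2.1)
  map_zero' := by simp
  map_add' p q := by
    simp only [Prod.fst_add, Prod.snd_add, Nat.cast_add]
    ring

/-- Writes a `2 × 2` matrix of degree zero as a sum of rows and columns, and evaluates the rows
at `q.1`, `q.2.1` and the columns at `q.2.2.1`, `q.2.2.2`. -/
def squareEval (q : M × M × M × M) (p : ℕ × ℕ × ℕ × ℕ) : M :=
  min p.1 p.2.1 • q.1 + (p.2.2.1 - (p.1 - p.2.1)) • q.2.1 + (p.1 - p.2.1) • q.2.2.1 +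
    (p.2.1 - p.1) • q.2.2.2

theorem squareEval_rows_cols {q : M × M × M × M} (hq : q.1 + q.2.1 = q.2.2.1 + q.2.2.2)
    (i i' j j' : ℕ) :
    squareEval q (i + j, i + j', i' + j, i' + j') =
      i • q.1 + i' • q.2.1 + j • q.2.2.1 + j' • q.2.2.2 := by
  have key : ∀ n : ℕ, n • q.1 + n • q.2.1 = n • q.2.2.1 + n • q.2.2.2 := fun n => by
    rw [← nsmul_add, hq, nsmul_add]
  rcases Nat.le_total j j' with h | h
  · obtain ⟨d, rfl⟩ := Nat.exists_eq_add_of_le h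
    have e₁ : min (i + j) (i + (j + d)) = i + j := by omega
    have e₂ : i + j - (i + (j + d)) = 0 := by omega
    have e₃ : i + (j + d) - (i + j) = d := by omega
    simp only [squareEval, e₁, e₂, e₃, Nat.sub_zero, zero_nsmul, add_zero, add_nsmul]
    calc _ = i • q.1 + i' • q.2.1 + (j • q.1 + j • q.2.1) + d • q.2.2.2 := by abel
      _ = _ := by rw [key]; abel
  · obtain ⟨d, rfl⟩ := Nat.exists_eq_add_of_le h
    have e₁ : min (i + (j' + d)) (i + j') = i + j' := by omega
    have e₂ : i + (j' + d) - (i + j') = d := by omega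
    have e₃ : i + j' - (i + (j' + d)) = 0 := by omega
    have e₄ : i' + (j' + d) - d = i' + j' := by omega
    simp only [squareEval, e₁, e₂, e₃, e₄, zero_nsmul, add_zero, add_nsmul]
    calc _ = i • q.1 + i' • q.2.1 + (j' • q.1 + j' • q.2.1) + d • q.2.2.1 := by abel
      _ = _ := by rw [key]; abel

theorem exists_rows_cols_of_squareDegree_eq_zero {p : ℕ × ℕ × ℕ × ℕ} (hp : squareDegree p = 0) :
    ∃ i i' j j' : ℕ, p = (i + j, i + j', i' + j, i' + j') := by
  obtain ⟨a, b, c, d⟩ := p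
  have h : (a + d : ℤ) - (b + c) = 0 := hp
  refine ⟨min a b, c - (a - b), a - b, b - a, ?_⟩
  simp only [Prod.mk.injEq]
  omega

theorem squareEval_add {q : M × M × M × M} (hq : q.1 + q.2.1 = q.2.2.1 + q.2.2.2)
    {p p' : ℕ × ℕ × ℕ × ℕ} (hp : squareDegree p = 0) (hp' : squareDegree p' = 0) :
    squareEval q (p + p') = squareEval q p + squareEval q p' := by
  obtain ⟨i, i', j, j', rfl⟩ := exists_rows_cols_of_squareDegree_eq_zero hp
  obtain ⟨k, k', l, l', rfl⟩ := exists_rows_cols_of_squareDegree_eq_zero hp'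
  have e : ((i + j, i + j', i' + j, i' + j') + (k + l, k + l', k' + l, k' + l') : ℕ × ℕ × ℕ × ℕ) =
      ((i + k) + (j + l), (i + k) + (j' + l'), (i' + k') + (j + l), (i' + k') + (j' + l')) := by
    simp only [Prod.mk_add_mk, Prod.mk.injEq]
    omega
  rw [e, squareEval_rows_cols hq, squareEval_rows_cols hq, squareEval_rows_cols hq]
  simp only [add_nsmul]
  abel

theorem squareEval_zero (q : M × M × M × M) : squareEval q 0 = 0 := by
  simp [squareEval]

theorem eq_zero_of_squareEval_eq_zero (hM : IsConical M) {q : M × M × M × M}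
    (hq : q.1 + q.2.1 = q.2.2.1 + q.2.2.2)
    (hne : q.1 ≠ 0 ∧ q.2.1 ≠ 0 ∧ q.2.2.1 ≠ 0 ∧ q.2.2.2 ≠ 0)
    {p : ℕ × ℕ × ℕ × ℕ} (hp : squareDegree p = 0) (h : squareEval q p = 0) : p = 0 := by
  obtain ⟨i, i', j, j', rfl⟩ := exists_rows_cols_of_squareDegree_eq_zero hp
  rw [squareEval_rows_cols hq] at h
  obtain ⟨h, hj'⟩ := hM _ _ h
  obtain ⟨h, hj⟩ := hM _ _ h
  obtain ⟨hi, hi'⟩ := hM _ _ h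
  obtain rfl := hM.eq_zero_of_nsmul_eq_zero hne.1 hi
  obtain rfl := hM.eq_zero_of_nsmul_eq_zero hne.2.1 hi'
  obtain rfl := hM.eq_zero_of_nsmul_eq_zero hne.2.2.1 hj
  obtain rfl := hM.eq_zero_of_nsmul_eq_zero hne.2.2.2 hj'
  rfl

end SquareEval

section OneStep

variable (M : Type u) [AddCommMonoid M]

/-- The equations `a₀ + a₁ = b₀ + b₁` in `M` with nonzero entries. -/
abbrev RefinementProblem : Type u :=
  {q : M × M × M × M // q.1 + q.2.1 = q.2.2.1 + q.2.2.2 ∧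
    q.1 ≠ 0 ∧ q.2.1 ≠ 0 ∧ q.2.2.1 ≠ 0 ∧ q.2.2.2 ≠ 0}

/-- `M` with the four entries of a refinement matrix freely adjoined for each problem. -/
abbrev FreeRefinement : Type u := M × (RefinementProblem M →₀ ℕ × ℕ × ℕ × ℕ)

namespace FreeRefinement

variable {M}

/-- The degree of each of the adjoined matrices. -/
def degree : FreeRefinement M →+ (RefinementProblem M → ℤ) where
  toFun x r := squareDegree (x.2 r)
  map_zero' := by ext; simp
  map_add' x y := by ext; simp

/-- The value in `M` of an element of degree zero. -/
noncomputable def eval (x : FreeRefinement M) : M :=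
  x.1 + x.2.sum fun r p => squareEval r.1 p

theorem eval_add (x y : FreeRefinement M) (hx : degree x = 0) (hy : degree y = 0) :
    eval (x + y) = eval x + eval y := by
  classical
  have hsum : ∀ n : RefinementProblem M →₀ ℕ × ℕ × ℕ × ℕ,
      n.support ⊆ x.2.support ∪ y.2.support →
      (n.sum fun r p => squareEval r.1 p) =
        ∑ r ∈ x.2.support ∪ y.2.support, squareEval r.1 (n r) := fun n hn =>
    Finsupp.sum_of_support_subset _ hn _ fun r _ => squareEval_zero r.1
  simp only [eval, Prod.fst_add, Prod.snd_add]
  rw [hsum _ Finsupp.support_add, hsum _ Finset.subset_union_left,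
    hsum _ Finset.subset_union_right, add_add_add_comm, ← Finset.sum_add_distrib]
  congr 1
  refine Finset.sum_congr rfl fun r _ => ?_
  exact squareEval_add r.2.1 (congrFun hx r) (congrFun hy r)

theorem eval_inl (m : M) : eval (m, 0) = m := by
  simp [eval]

theorem eval_single (r : RefinementProblem M) (p : ℕ × ℕ × ℕ × ℕ) :
    eval (0, Finsupp.single r p) = squareEval r.1 p := by
  simp [eval, squareEval_zero]

theorem degree_inl (m : M) : degree ((m, 0) : FreeRefinement M) = 0 := by
  ext; simp [degree]

theorem degree_single {r : RefinementProblem M} {p : ℕ × ℕ × ℕ × ℕ} (hp : squareDegree p = 0) :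
    degree ((0, Finsupp.single r p) : FreeRefinement M) = 0 := by
  classical
  ext r'
  by_cases h : r = r'
  · subst h; simp [degree, hp]
  · simp [degree, Finsupp.single_eq_of_ne' h]

theorem exists_degree_add_eq_zero (x : FreeRefinement M) : ∃ z, degree (x + z) = 0 := by
  refine ⟨(0, x.2.mapRange (fun p => (p.2.1, p.1, p.2.2.2, p.2.2.1)) rfl), ?_⟩
  ext r
  simp only [degree, squareDegree, AddMonoidHom.coe_mk, ZeroHom.coe_mk, Prod.fst_add, Prod.snd_add,
    Finsupp.add_apply, Finsupp.mapRange_apply, Nat.cast_add, Pi.zero_apply]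
  ring

theorem isConical (hM : IsConical M) : IsConical (FreeRefinement M) := by
  rintro ⟨m, n⟩ ⟨m', n'⟩ h
  obtain ⟨h₁, h₂⟩ := Prod.mk.inj h
  obtain ⟨rfl, rfl⟩ := hM _ _ h₁
  have h₃ : ∀ r, n r = 0 ∧ n' r = 0 := fun r => add_eq_zero.1 (DFunLike.congr_fun h₂ r)
  obtain rfl : n = 0 := Finsupp.ext fun r => (h₃ r).1
  obtain rfl : n' = 0 := Finsupp.ext fun r => (h₃ r).2
  exact ⟨rfl, rfl⟩

theorem eq_zero_of_eval_eq_zero (hM : IsConical M) (x : FreeRefinement M) (hx : degree x = 0)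
    (h : eval x = 0) : x = 0 := by
  obtain ⟨m, n⟩ := x
  obtain ⟨h₁, h₂⟩ := hM _ _ h
  obtain rfl : m = 0 := h₁
  have hsum : ∀ s : Finset (RefinementProblem M), ∑ r ∈ s, squareEval r.1 (n r) = 0 →
      ∀ r ∈ s, squareEval r.1 (n r) = 0 := by
    classical
    intro s
    induction s using Finset.induction_on with
    | empty => simp
    | insert r s hr ih =>
      intro hs
      rw [Finset.sum_insert hr] at hs
      obtain ⟨hs₁, hs₂⟩ := hM _ _ hs
      simpa [hs₁] using ih hs₂
  have hn : n = 0 := by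
    ext1 r
    by_contra hr
    exact hr (eq_zero_of_squareEval_eq_zero hM r.2.1 r.2.2 (congrFun hx r)
      (hsum _ h₂ r (Finsupp.mem_support_iff.2 hr)))
  rw [hn]
  rfl

end FreeRefinement

open FreeRefinement in
theorem refines_degreeZeroCon :
    Refines ((degreeZeroCon (degree (M := M)) eval).mk'.comp (AddMonoidHom.inl M _)) := by
  intro a₀ a₁ b₀ b₁ h
  set f := (degreeZeroCon (degree (M := M)) eval).mk'.comp (AddMonoidHom.inl M _)
  by_cases h₁ : a₀ = 0
  · subst h₁
    rw [zero_add] at h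
    exact ⟨0, 0, f b₀, f b₁, by simp, by rw [h, map_add], by simp, by simp⟩
  by_cases h₂ : a₁ = 0
  · subst h₂
    rw [add_zero] at h
    exact ⟨f b₀, f b₁, 0, 0, by rw [h, map_add], by simp, by simp, by simp⟩
  by_cases h₃ : b₀ = 0
  · subst h₃
    rw [zero_add] at h
    exact ⟨0, f a₀, 0, f a₁, by simp, by simp, by simp, by rw [← h, map_add]⟩
  by_cases h₄ : b₁ = 0
  · subst h₄
    rw [add_zero] at h
    exact ⟨f a₀, 0, f a₁, 0, by simp, by simp, by rw [← h, map_add], by simp⟩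
  let r : RefinementProblem M := ⟨(a₀, a₁, b₀, b₁), h, h₁, h₂, h₃, h₄⟩
  have key : ∀ (m : M) (p p' : ℕ × ℕ × ℕ × ℕ), squareDegree (p + p') = 0 →
      squareEval r.1 (p + p') = m →
      f m = (degreeZeroCon degree eval).mk' (0, Finsupp.single r p) +
        (degreeZeroCon degree eval).mk' (0, Finsupp.single r p') := by
    intro m p p' hp hm
    rw [← map_add, Prod.mk_add_mk, add_zero, ← Finsupp.single_add]
    exact degreeZeroCon_mk_eq eval_add (degree_inl m) (degree_single hp)
      ((eval_inl m).trans ((eval_single r _).trans hm).symm)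
  refine ⟨_, _, _, _, key a₀ (1, 0, 0, 0) (0, 1, 0, 0) ?_ ?_, key a₁ (0, 0, 1, 0) (0, 0, 0, 1) ?_ ?_,
    key b₀ _ _ ?_ ?_, key b₁ _ _ ?_ ?_⟩ <;> simp [squareDegree, squareEval, r]

end OneStep

theorem IsConical.exists_isStronglyUnitary_refines {M : Type u} [AddCommMonoid M]
    (hM : IsConical M) :
    ∃ (N : Type u) (_ : AddCommMonoid N) (f : M →+ N),
      IsConical N ∧ IsStronglyUnitary f ∧ Refines f :=
  ⟨_, inferInstance, _,
    isConical_degreeZeroCon (FreeRefinement.isConical hM)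
      (FreeRefinement.eval_inl 0) (FreeRefinement.eq_zero_of_eval_eq_zero hM),
    isStronglyUnitary_degreeZeroCon FreeRefinement.eval_add (AddMonoidHom.inl M _)
      FreeRefinement.degree_inl FreeRefinement.eval_inl FreeRefinement.exists_degree_add_eq_zero,
    refines_degreeZeroCon M⟩

section Limit

variable {G : ℕ → Type u} [∀ i, AddCommMonoid (G i)] (s : ∀ i, G i →+ G (i + 1))

/-- The transition maps of the directed system generated by a sequence of homomorphisms. -/
def transition (i j : ℕ) (h : i ≤ j) : G i →+ G j :=
  Nat.leRec (motive := fun j _ => G i →+ G j) (AddMonoidHom.id _) (fun j _ g => (s j).comp g) h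

theorem transition_self (i : ℕ) : transition s i i le_rfl = AddMonoidHom.id _ :=
  Nat.leRec_self _ _

theorem transition_succ {i j : ℕ} (h : i ≤ j) (h' : i ≤ j + 1) :
    transition s i (j + 1) h' = (s j).comp (transition s i j h) :=
  Nat.leRec_succ _ _ _

theorem transition_comp {i j k : ℕ} (hij : i ≤ j) (hjk : j ≤ k) :
    (transition s j k hjk).comp (transition s i j hij) = transition s i k (hij.trans hjk) := by
  induction hjk with
  | refl => rw [transition_self, AddMonoidHom.id_comp]
  | step hjk ih =>
    rw [transition_succ s hjk, transition_succ s (hij.trans hjk), AddMonoidHom.comp_assoc, ih]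

instance transition_directedSystem : DirectedSystem G (transition s · · ·) where
  map_self i x := by rw [transition_self]; rfl
  map_map k j i hij hjk x := by rw [← transition_comp s hij hjk]; rfl

variable {s}

theorem isStronglyUnitary_transition (hs : ∀ i, IsStronglyUnitary (s i)) {i j : ℕ} (h : i ≤ j) :
    IsStronglyUnitary (transition s i j h) := by
  induction h with
  | refl => rw [transition_self]; exact .id _
  | step h ih => rw [transition_succ s h]; exact (hs _).comp ih

theorem exists_refinement_limit (hG : ∀ i, IsConical (G i)) (hs : ∀ i, IsStronglyUnitary (s i))
    (hr : ∀ i, Refines (s i)) :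
    ∃ (N : Type u) (_ : AddCommMonoid N),
      IsConical N ∧ IsRefinementMonoid N ∧ ∃ f : G 0 →+ N, IsStronglyUnitary f := by
  let of (i : ℕ) : G i →+ DirectLimit G (transition s) :=
    { toFun := fun x => ⟦⟨i, x⟩⟧
      map_zero' := (DirectLimit.zero_def i).symm
      map_add' := fun x y => (DirectLimit.add_def i x y).symm }
  have of_inj : ∀ i, Function.Injective (of i) := DirectLimit.mk_injective _ fun i j h =>
    (isStronglyUnitary_transition hs h).1.1
  have of_transition : ∀ {i j : ℕ} (h : i ≤ j) (x : G i), of j (transition s i j h x) = of i x :=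
    fun h x => DirectLimit.mk_apply _ _ x h
  have of_succ : ∀ (i : ℕ) (x : G i), of (i + 1) (s i x) = of i x := fun i x => by
    rw [← of_transition (Nat.le_succ i), transition_succ s le_rfl, transition_self]
    rfl
  refine ⟨DirectLimit G (transition s), inferInstance, fun x y => ?_, fun a₀ a₁ b₀ b₁ => ?_, of 0,
    ⟨of_inj 0, fun b => ?_, fun a₀ a₁ b => ?_⟩, fun m hm b => ?_⟩
  · induction x, y using DirectLimit.induction₂ with | ih i x y
    intro h
    change of i x + of i y = 0 at h
    obtain ⟨rfl, rfl⟩ := hG i x y (of_inj i (by simpa using h))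
    exact ⟨map_zero (of i), map_zero (of i)⟩
  · obtain ⟨i, x₀, x₁, y₀, rfl, rfl, rfl⟩ := DirectLimit.exists_eq_mk₃ _ a₀ a₁ b₀
    obtain ⟨j, y₁, rfl⟩ := DirectLimit.exists_eq_mk _ b₁
    intro h
    change of i x₀ + of i x₁ = of i y₀ + of j y₁ at h
    change ∃ c₀₀ c₀₁ c₁₀ c₁₁, of i x₀ = _ ∧ of i x₁ = _ ∧ of i y₀ = _ ∧ of j y₁ = _
    obtain ⟨k, hik, hjk⟩ := exists_ge_ge i j
    simp only [← of_transition hik, ← of_transition hjk, ← map_add] at h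
    replace h := of_inj k h
    rw [map_add] at h
    obtain ⟨c₀₀, c₀₁, c₁₀, c₁₁, h₁, h₂, h₃, h₄⟩ := hr k _ _ _ _ h
    refine ⟨of (k + 1) c₀₀, of (k + 1) c₀₁, of (k + 1) c₁₀, of (k + 1) c₁₁, ?_⟩
    rw [← of_transition hik, ← of_transition hik, ← of_transition hik, ← of_transition hjk]
    simp only [← of_succ k, ← map_add, h₁, h₂, h₃, h₄, and_self]
  all_goals
    obtain ⟨i, b, rfl⟩ := DirectLimit.exists_eq_mk _ b
    obtain ⟨⟨-, cof, uni⟩, div⟩ := isStronglyUnitary_transition hs (Nat.zero_le i)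
  · obtain ⟨a, z, hz⟩ := cof b
    refine ⟨a, of i z, ?_⟩
    rw [← of_transition (Nat.zero_le i), ← hz, map_add]
    rfl
  · change of 0 a₀ + of i b = of 0 a₁ → of i b ∈ _
    intro h
    rw [← of_transition (Nat.zero_le i), ← of_transition (Nat.zero_le i), ← map_add] at h
    obtain ⟨a, rfl⟩ := uni _ _ _ (of_inj i h)
    exact ⟨a, (of_transition _ a).symm⟩
  · change m • of i b ∈ _ → of i b ∈ _
    rintro ⟨a, h⟩
    rw [← of_transition (Nat.zero_le i), ← map_nsmul] at h
    obtain ⟨a', rfl⟩ := div m hm _ ⟨a, of_inj i h⟩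
    exact ⟨a', (of_transition _ a').symm⟩

end Limit

/-- Every cone admits a strongly unitary embedding into a refinement cone. -/
theorem cone_stronglyUnitary_embeds_into_refinement_cone
    (M : Type u) [AddCommMonoid M] (hM : IsConical M) :
    ∃ (N : Type u) (_ : AddCommMonoid N),
      IsConical N ∧ IsRefinementMonoid N ∧ ∃ f : M →+ N, IsStronglyUnitary f := by
  let Cone := Σ' (A : Type u) (_ : AddCommMonoid A), IsConical A
  let _ (A : Cone) : AddCommMonoid A.1 := A.2.1
  have step : ∀ A : Cone, ∃ (B : Cone) (f : A.1 →+ B.1), IsStronglyUnitary f ∧ Refines f := by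
    rintro ⟨A, _, hA⟩
    obtain ⟨N, _, f, hN, hf⟩ := hA.exists_isStronglyUnitary_refines
    exact ⟨⟨N, _, hN⟩, f, hf⟩
  choose next f hf using step
  let G : ℕ → Cone := fun n => Nat.rec ⟨M, _, hM⟩ (fun _ A => next A) n
  exact exists_refinement_limit (G := fun i => (G i).1) (s := fun i => f (G i))
    (fun i => (G i).2.2) (fun i => (hf (G i)).1) (fun i => (hf (G i)).2)
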